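/- Let b > 0 and for z ∈ ℂ with |Im z| ≤ 1/2 define I(z) = ∫₀^∞ (dt/t)( sin(2tb²z)/(2 sinh(b²t) sinh t) − z/t ), an absolutely convergent integral of a complex-valued function, and set S_k(z) = exp(i·I(z)). Then for every real x: S_k(x + i/2) = 2 cosh(πb²x) · S_k(x − i/2). -/

import Mathlib

open Complex MeasureTheory

/-- The integrand of the defining integral of `log S_k`. -/
noncomputable def skIntegrand (b : ℝ) (z : ℂ) (t : ℝ) : ℂ :=
  (1 / (t : ℂ)) *
    (Complex.sin (2 * (t : ℂ) * (b : ℂ) ^ 2 * z) /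
        (2 * Complex.sinh ((b : ℂ) ^ 2 * (t : ℂ)) * Complex.sinh (t : ℂ)) -
      z / (t : ℂ))

/-- `I(z) = ∫₀^∞ (dt/t) ( sin(2tb²z)/(2 sinh(b²t) sinh t) - z/t )`. -/
noncomputable def skI (b : ℝ) (z : ℂ) : ℂ :=
  ∫ t in Set.Ioi (0 : ℝ), skIntegrand b z t

/-- The special function `S_k(z) = exp(i I(z))`. -/
noncomputable def Sk (b : ℝ) (z : ℂ) : ℂ :=
  Complex.exp (Complex.I * skI b z)

theorem sk_sin_bound (w : ℂ) (hw : ‖w‖ ≤ 1) : ‖Complex.sin w - w‖ ≤ ‖w‖ ^ 3 := by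
  have h := Complex.sin_bound hw
  have e : Complex.sin w - w = (Complex.sin w - (w - w ^ 3 / 6)) - w ^ 3 / 6 := by ring
  rw [e]
  have h1 := norm_sub_le (Complex.sin w - (w - w ^ 3 / 6)) (w ^ 3 / 6)
  have h2 : ‖w ^ 3 / 6‖ = ‖w‖ ^ 3 / 6 := by simp
  have h3 : ‖w‖ ^ 5 ≤ ‖w‖ ^ 3 := pow_le_pow_of_le_one (norm_nonneg _) hw (by norm_num)
  have h4 : 0 ≤ ‖w‖ ^ 3 := by positivity
  rw [h2] at h1
  linarith

theorem sk_sinh_bound (w : ℂ) (hw : ‖w‖ ≤ 1) : ‖Complex.sinh w - w‖ ≤ ‖w‖ ^ 3 := by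
  have h := sk_sin_bound (w * I) (by simpa using hw)
  rw [Complex.sin_mul_I, ← sub_mul] at h
  simpa using h

theorem sk_norm_sinh (t : ℝ) (ht : 0 ≤ t) : ‖Complex.sinh (t : ℂ)‖ = Real.sinh t := by
  rw [← Complex.ofReal_sinh, Complex.norm_real, Real.norm_of_nonneg (Real.sinh_nonneg_iff.2 ht)]

theorem sk_bot (c : ℝ) (hc : 0 < c) (z : ℂ) : ∃ C : ℝ, ∀ᶠ t : ℝ in nhdsWithin 0 (Set.Ioi 0),
    ‖(1 / (t : ℂ)) * (Complex.sin (2 * (t : ℂ) * (c : ℂ) * z) /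
        (2 * Complex.sinh ((c : ℂ) * (t : ℂ)) * Complex.sinh (t : ℂ)) - z / (t : ℂ))‖ ≤ C := by
  refine ⟨((2 * c * ‖z‖) ^ 3 + 2 * ‖z‖ * (2 * c ^ 3 + c)) / (2 * c), ?_⟩
  have e1 : ∀ᶠ t : ℝ in nhdsWithin 0 (Set.Ioi 0), t * (2 * c * ‖z‖) < 1 := by
    apply Filter.Eventually.filter_mono nhdsWithin_le_nhds
    exact (by fun_prop : Continuous fun t : ℝ => t * (2 * c * ‖z‖)).continuousAt.eventually_lt
      continuousAt_const (by simp)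
  have e2 : ∀ᶠ t : ℝ in nhdsWithin 0 (Set.Ioi 0), t * c < 1 := by
    apply Filter.Eventually.filter_mono nhdsWithin_le_nhds
    exact (by fun_prop : Continuous fun t : ℝ => t * c).continuousAt.eventually_lt
      continuousAt_const (by simp)
  have e3 : ∀ᶠ t : ℝ in nhdsWithin 0 (Set.Ioi 0), t < 1 := by
    apply Filter.Eventually.filter_mono nhdsWithin_le_nhds
    exact eventually_lt_nhds one_pos
  filter_upwards [e1, e2, e3, self_mem_nhdsWithin] with t h1 h2 h3 (h0 : 0 < t)
  have hs1 : t ≤ Real.sinh t := Real.self_le_sinh_iff.2 h0.le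
  have hct : 0 < c * t := by positivity
  have hs2 : c * t ≤ Real.sinh (c * t) := Real.self_le_sinh_iff.2 hct.le
  have n1 := sk_norm_sinh t h0.le
  have n2 := sk_norm_sinh (c * t) hct.le
  push_cast at n2
  have nt : ‖(t : ℂ)‖ = t := by simp [abs_of_pos h0]
  have nct : ‖(c : ℂ) * t‖ = c * t := by simp [abs_of_pos h0, abs_of_pos hc]
  have b1 := sk_sinh_bound t (by rw [nt]; exact h3.le)
  have b2 := sk_sinh_bound ((c : ℂ) * t) (by rw [nct]; linarith)
  have nw : ‖2 * (t : ℂ) * (c : ℂ) * z‖ = t * (2 * c * ‖z‖) := by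
    simp [abs_of_pos h0, abs_of_pos hc]; ring
  have b3 := sk_sin_bound (2 * (t : ℂ) * (c : ℂ) * z) (by rw [nw]; exact h1.le)
  rw [nw] at b3
  rw [nt] at b1
  rw [nct] at b2
  have z1 : (t : ℂ) ≠ 0 := by exact_mod_cast h0.ne'
  have z2 : Complex.sinh (t : ℂ) ≠ 0 := by
    rw [← norm_ne_zero_iff, n1]; linarith
  have z3 : Complex.sinh ((c : ℂ) * t) ≠ 0 := by
    rw [← norm_ne_zero_iff, n2]; linarith
  set S := Complex.sin (2 * (t : ℂ) * (c : ℂ) * z)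
  set A := Complex.sinh (t : ℂ)
  set B := Complex.sinh ((c : ℂ) * t)
  have key : (1 / (t : ℂ)) * (S / (2 * B * A) - z / (t : ℂ)) =
      (t * (S - 2 * (t : ℂ) * (c : ℂ) * z) - 2 * z * ((B - c * t) * A + c * t * (A - t))) /
        (2 * t ^ 2 * B * A) := by
    field_simp
    ring
  have nA : ‖A‖ ≤ 2 * t := by
    have : ‖A‖ ≤ ‖A - t‖ + ‖(t : ℂ)‖ := by
      simpa using norm_add_le (A - t) (t : ℂ)
    have : t ^ 3 ≤ t := by simpa using pow_le_pow_of_le_one h0.le h3.le (show 1 ≤ 3 by norm_num)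
    linarith
  have num : ‖(t * (S - 2 * (t : ℂ) * (c : ℂ) * z) -
      2 * z * ((B - c * t) * A + c * t * (A - t)))‖ ≤
      t ^ 4 * ((2 * c * ‖z‖) ^ 3 + 2 * ‖z‖ * (2 * c ^ 3 + c)) := by
    calc _ ≤ t * ‖S - 2 * (t : ℂ) * (c : ℂ) * z‖ +
          2 * ‖z‖ * (‖B - c * t‖ * ‖A‖ + c * t * ‖A - t‖) := by
          refine (norm_sub_le _ _).trans ?_
          rw [norm_mul, nt, norm_mul, norm_mul]
          simp only [Complex.norm_ofNat]
          gcongr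
          refine (norm_add_le _ _).trans ?_
          rw [norm_mul, norm_mul, nct]
      _ ≤ t * (t * (2 * c * ‖z‖)) ^ 3 +
          2 * ‖z‖ * ((c * t) ^ 3 * (2 * t) + c * t * t ^ 3) := by gcongr
      _ = _ := by ring
  rw [key, norm_div]
  have nd : ‖2 * (t : ℂ) ^ 2 * B * A‖ = 2 * t ^ 2 * Real.sinh (c * t) * Real.sinh t := by
    simp [n1, n2, abs_of_pos h0]
  rw [nd, div_le_div_iff₀ (by nlinarith [mul_pos (mul_pos (pow_pos h0 2) (hct.trans_le hs2)) (h0.trans_le hs1)]) (by positivity)]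
  have d : t ^ 4 * (2 * c) ≤ 2 * t ^ 2 * Real.sinh (c * t) * Real.sinh t := by
    calc t ^ 4 * (2 * c) = 2 * t ^ 2 * (c * t) * t := by ring
      _ ≤ _ := by gcongr
  calc _ ≤ t ^ 4 * ((2 * c * ‖z‖) ^ 3 + 2 * ‖z‖ * (2 * c ^ 3 + c)) * (2 * c) := by gcongr
    _ = ((2 * c * ‖z‖) ^ 3 + 2 * ‖z‖ * (2 * c ^ 3 + c)) * (t ^ 4 * (2 * c)) := by ring
    _ ≤ _ := by gcongr

theorem sk_norm_sin (w : ℂ) : ‖Complex.sin w‖ ≤ Real.exp |w.im| := by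
  rw [Complex.sin]
  have h1 : ‖Complex.exp (-w * I)‖ ≤ Real.exp |w.im| := by
    rw [Complex.norm_exp]; simp [le_abs_self]
  have h2 : ‖Complex.exp (w * I)‖ ≤ Real.exp |w.im| := by
    rw [Complex.norm_exp]; simp [neg_le_abs]
  have h3 := norm_sub_le (Complex.exp (-w * I)) (Complex.exp (w * I))
  simp only [norm_div, norm_mul, Complex.norm_I, Complex.norm_ofNat]
  linarith

theorem sk_top (c : ℝ) (hc : 0 < c) (z : ℂ) (hz : |z.im| ≤ 1 / 2) :
    ∀ᶠ t : ℝ in Filter.atTop,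
    ‖(1 / (t : ℂ)) * (Complex.sin (2 * (t : ℂ) * (c : ℂ) * z) /
        (2 * Complex.sinh ((c : ℂ) * (t : ℂ)) * Complex.sinh (t : ℂ)) - z / (t : ℂ))‖ ≤
      (2 + ‖z‖) * (1 / t ^ 2) := by
  filter_upwards [Filter.eventually_ge_atTop (1 / c), Filter.eventually_gt_atTop 0] with t h1 h0
  have hct : 1 ≤ c * t := by rw [div_le_iff₀ hc] at h1; linarith
  have hs1 : t ≤ Real.sinh t := Real.self_le_sinh_iff.2 h0.le
  have n1 := sk_norm_sinh t h0.le
  have n2 := sk_norm_sinh (c * t) (by linarith)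
  push_cast at n2
  have nt : ‖(t : ℂ)‖ = t := by simp [abs_of_pos h0]
  have hs2 : Real.exp (c * t) / 4 ≤ Real.sinh (c * t) := by
    rw [Real.sinh_eq]
    have a1 : 2 ≤ Real.exp (c * t) := by linarith [Real.add_one_le_exp (c * t)]
    have a2 : Real.exp (-(c * t)) ≤ 1 := Real.exp_le_one_iff.2 (by linarith)
    linarith
  have hS : ‖Complex.sin (2 * (t : ℂ) * (c : ℂ) * z)‖ ≤ Real.exp (c * t) := by
    refine (sk_norm_sin _).trans (Real.exp_le_exp.2 ?_)
    have : (2 * (t : ℂ) * (c : ℂ) * z).im = 2 * (c * t) * z.im := by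
      have : (2 * (t : ℂ) * (c : ℂ) * z) = ((2 * (c * t) : ℝ) : ℂ) * z := by push_cast; ring
      rw [this, Complex.im_ofReal_mul]
    rw [this, abs_mul, abs_of_pos (by linarith)]
    nlinarith
  have hE := Real.exp_pos (c * t)
  have hm : ‖Complex.sin (2 * (t : ℂ) * (c : ℂ) * z) /
        (2 * Complex.sinh ((c : ℂ) * (t : ℂ)) * Complex.sinh (t : ℂ))‖ ≤ 2 / t := by
    rw [norm_div, norm_mul, norm_mul, n1, n2, Complex.norm_ofNat]
    rw [div_le_div_iff₀ (by
      have : 0 < Real.sinh (c * t) := by linarith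
      have : 0 < Real.sinh t := by linarith
      positivity) h0]
    calc _ ≤ Real.exp (c * t) * t := by gcongr
      _ = 2 * (2 * (Real.exp (c * t) / 4) * t) := by ring
      _ ≤ _ := by gcongr
  rw [norm_mul, norm_div, nt, norm_one]
  calc _ ≤ 1 / t * (2 / t + ‖z‖ / t) := by
        gcongr
        refine (norm_sub_le _ _).trans ?_
        rw [norm_div z, nt]
        gcongr
    _ = _ := by field_simp

theorem sk_integrable (b : ℝ) (hb : 0 < b) (z : ℂ) (hz : |z.im| ≤ 1/2) :
    IntegrableOn (skIntegrand b z) (Set.Ioi 0) := by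
  have hc : 0 < b ^ 2 := by positivity
  have hcont : ContinuousOn (skIntegrand b z) (Set.Ioi 0) := by
    unfold skIntegrand
    intro t ht
    have h0 : 0 < t := ht
    have z1 : (t : ℂ) ≠ 0 := by exact_mod_cast h0.ne'
    have z2 : Complex.sinh (t : ℂ) ≠ 0 := by
      rw [← norm_ne_zero_iff, sk_norm_sinh t h0.le]
      exact (Real.sinh_pos_iff.2 h0).ne'
    have z3 : Complex.sinh ((b : ℂ) ^ 2 * t) ≠ 0 := by
      have := sk_norm_sinh (b ^ 2 * t) (by positivity)
      push_cast at this
      rw [← norm_ne_zero_iff, this]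
      exact (Real.sinh_pos_iff.2 (by positivity)).ne'
    apply ContinuousAt.continuousWithinAt
    have z4 : 2 * Complex.sinh ((b : ℂ) ^ 2 * t) * Complex.sinh (t : ℂ) ≠ 0 := by
      simp [z2, z3]
    fun_prop (disch := assumption)
  have hl := hcont.locallyIntegrableOn (μ := volume) measurableSet_Ioi
  have hm : MellinConvergent (skIntegrand b z) 1 := by
    refine mellinConvergent_of_isBigO_rpow (a := 2) (b := 0) hl ?_ (by simp) ?_ (by simp)
    · apply Asymptotics.IsBigO.of_bound (2 + ‖z‖)
      filter_upwards [sk_top (b ^ 2) hc z hz, Filter.eventually_gt_atTop 0] with t ht h0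
      rw [Real.rpow_neg h0.le, Real.rpow_two, Real.norm_of_nonneg (by positivity), ← one_div]
      unfold skIntegrand
      push_cast at ht
      exact ht
    · obtain ⟨C, hC⟩ := sk_bot (b ^ 2) hc z
      apply Asymptotics.IsBigO.of_bound C
      filter_upwards [hC] with t ht
      unfold skIntegrand
      push_cast at ht
      simpa using ht
  unfold MellinConvergent at hm
  simpa using hm

theorem sk_coth_series (a : ℝ) (ha : a ≠ 0) :
    HasSum (fun n : ℕ => 2 * a / (a ^ 2 + ((n : ℝ) + 1) ^ 2))
      (Real.pi * (Real.cosh (Real.pi * a) / Real.sinh (Real.pi * a)) - 1 / a) := by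
  have hz : (a : ℂ) * I ∈ Complex.integerComplement := by
    rw [Complex.mem_integerComplement_iff]
    rintro ⟨n, hn⟩
    have := congrArg Complex.im hn
    simp at this
    exact ha this.symm
  have h := (summable_cotTerm hz).hasSum
  rw [← cot_series_rep' hz] at h
  have h2 := h.mul_left I
  rw [← Complex.hasSum_ofReal]
  have ha' : (a : ℂ) ≠ 0 := by exact_mod_cast ha
  have hs : Complex.sinh (Real.pi * a) ≠ 0 := by
    have : Real.sinh (Real.pi * a) ≠ 0 := by
      rw [Ne, Real.sinh_eq_zero]; exact mul_ne_zero Real.pi_ne_zero ha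
    exact_mod_cast this
  convert! h2 using 1
  · funext n
    have h3 : ((a : ℂ) ^ 2 + ((n : ℂ) + 1) ^ 2) ≠ 0 := by
      have : (a ^ 2 + ((n : ℝ) + 1) ^ 2) ≠ 0 := by positivity
      exact_mod_cast this
    have h4 : ((a : ℂ) * I - (n + 1)) ≠ 0 := by
      intro h; apply ha; simpa using congrArg Complex.im h
    have h5 : ((a : ℂ) * I + (n + 1)) ≠ 0 := by
      intro h; apply ha; simpa using congrArg Complex.im h
    have h6 : (a : ℂ) ^ 2 + ((n : ℂ) + 1) ^ 2 = - (((a : ℂ) * I - (n + 1)) * ((a : ℂ) * I + (n + 1))) := by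
      ring_nf; simp
    push_cast
    rw [h6]
    field_simp
    ring_nf
    simp
  · push_cast
    rw [Complex.cot, ← mul_assoc, Complex.sin_mul_I, Complex.cos_mul_I]
    field_simp

theorem sk_tanh_series (a : ℝ) :
    HasSum (fun n : ℕ => 2 * a / (a ^ 2 + (2 * (n : ℝ) + 1) ^ 2))
      (Real.pi / 2 * (Real.sinh (Real.pi * a / 2) / Real.cosh (Real.pi * a / 2))) := by
  by_cases ha : a = 0
  · simp [ha, hasSum_zero]
  have h1 := sk_coth_series a ha
  have h2 := (sk_coth_series (a / 2) (by simpa using ha)).mul_left (1 / 2)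
  have ho : HasSum (fun k : ℕ => 2 * a / (a ^ 2 + (((2 * k + 1 : ℕ) : ℝ) + 1) ^ 2))
      (1 / 2 * (Real.pi * (Real.cosh (Real.pi * (a / 2)) / Real.sinh (Real.pi * (a / 2))) - 1 / (a / 2))) := by
    convert! h2 using 1
    funext k
    push_cast
    have : a ^ 2 + (2 * (k : ℝ) + 1 + 1) ^ 2 = 4 * ((a / 2) ^ 2 + ((k : ℝ) + 1) ^ 2) := by ring
    rw [this]
    have : ((a / 2) ^ 2 + ((k : ℝ) + 1) ^ 2) ≠ 0 := by positivity
    field_simp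
    ring
  have he : Summable (fun k : ℕ => 2 * a / (a ^ 2 + (((2 * k : ℕ) : ℝ) + 1) ^ 2)) :=
    h1.summable.comp_injective (i := fun k : ℕ => 2 * k) (fun x y h => by simpa using h)
  have hu := (he.hasSum.even_add_odd (f := fun n : ℕ => 2 * a / (a ^ 2 + ((n : ℝ) + 1) ^ 2)) ho).unique h1
  have hh := he.hasSum
  rw [eq_sub_of_add_eq hu] at hh
  convert! hh using 1
  · funext n; push_cast; rfl
  · have hd : Real.pi * a = 2 * (Real.pi * a / 2) := by ring
    have hd2 : Real.pi * (a / 2) = Real.pi * a / 2 := by ring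
    rw [hd2, hd]
    have hu0 : 2 * (Real.pi * a / 2) / 2 = Real.pi * a / 2 := by ring
    rw [hu0]
    set u := Real.pi * a / 2 with hu
    have hs : Real.sinh u ≠ 0 := by
      rw [Ne, Real.sinh_eq_zero, hu]
      have := Real.pi_ne_zero
      positivity
    have hc := (Real.cosh_pos u).ne'
    rw [Real.cosh_two_mul, Real.sinh_two_mul]
    field_simp
    ring

theorem sk_sinh_lower (t : ℝ) (ht : 0 < t) : t / Real.sinh t ≤ 4 * Real.exp (-(1/2) * t) := by
  rw [div_le_iff₀ (Real.sinh_pos_iff.2 ht), Real.sinh_eq]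
  have e : 4 * Real.exp (-(1/2) * t) * ((Real.exp t - Real.exp (-t)) / 2) =
      2 * (Real.exp (t / 2) - Real.exp (-(3 * t / 2))) := by
    have h1 : Real.exp (t / 2) = Real.exp (-(1/2) * t) * Real.exp t := by
      rw [← Real.exp_add]; ring_nf
    have h2 : Real.exp (-(3 * t / 2)) = Real.exp (-(1/2) * t) * Real.exp (-t) := by
      rw [← Real.exp_add]; ring_nf
    rw [h1, h2]; ring
  rw [e]
  have h1 := Real.add_one_le_exp (t / 2)
  have h2 : Real.exp (-(3 * t / 2)) ≤ 1 := Real.exp_le_one_iff.2 (by linarith)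
  linarith

theorem sk_div_sinh_cont (f : ℝ → ℝ) (hf : Continuous f) :
    AEStronglyMeasurable (fun t => f t / Real.sinh t) (volume.restrict (Set.Ioi 0)) := by
  apply ContinuousOn.aestronglyMeasurable _ measurableSet_Ioi
  apply ContinuousOn.div hf.continuousOn Real.continuous_sinh.continuousOn
  intro t ht
  exact (Real.sinh_pos_iff.2 ht).ne'

theorem sk_div_sinh_int : IntegrableOn (fun t => t / Real.sinh t) (Set.Ioi 0) := by
  have h : IntegrableOn (fun t => 4 * Real.exp (-(1/2) * t)) (Set.Ioi 0) :=
    (integrableOn_exp_mul_Ioi (by norm_num) 0).const_mul 4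
  refine Integrable.mono' h (sk_div_sinh_cont _ continuous_id) ?_
  filter_upwards [ae_restrict_mem measurableSet_Ioi] with t (ht : 0 < t)
  have := Real.sinh_pos_iff.2 ht
  rw [Real.norm_of_nonneg (by positivity)]
  exact sk_sinh_lower t ht

theorem sk_geom (t : ℝ) (ht : 0 < t) :
    HasSum (fun n : ℕ => 2 * Real.exp (-(2 * (n : ℝ) + 1) * t)) (1 / Real.sinh t) := by
  have hq : Real.exp (-2 * t) < 1 := Real.exp_lt_one_iff.2 (by linarith)
  have h := (hasSum_geometric_of_lt_one (Real.exp_pos _).le hq).mul_left (2 * Real.exp (-t))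
  convert! h using 1
  · funext n
    rw [← Real.exp_nat_mul, mul_assoc, ← Real.exp_add]
    ring_nf
  · rw [Real.sinh_eq]
    have h2 : Real.exp (-2 * t) = Real.exp (-t) * Real.exp (-t) := by
      rw [← Real.exp_add]; ring_nf
    have h3 : Real.exp t * Real.exp (-t) = 1 := by
      rw [← Real.exp_add]; simp
    have h4 : Real.exp t - Real.exp (-t) > 0 := by
      have : Real.exp (-t) < Real.exp t := Real.exp_lt_exp.2 (by linarith)
      linarith
    have h5 : 1 - Real.exp (-2 * t) ≠ 0 := by linarith
    rw [h2] at h5 ⊢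
    rw [← div_eq_mul_inv, div_div_eq_mul_div, div_eq_div_iff h4.ne' h5]
    linear_combination (-2) * h3

theorem sk_int_sin (a m : ℝ) (hm : 0 < m) :
    ∫ t in Set.Ioi (0:ℝ), Real.sin (a * t) * (2 * Real.exp (-m * t)) = 2 * a / (a ^ 2 + m ^ 2) := by
  have hre : (-(m : ℂ) + a * I).re < 0 := by simpa using hm
  have h := integral_exp_mul_complex_Ioi hre 0
  have hi := integrableOn_exp_mul_complex_Ioi hre 0
  have h2 := congrArg Complex.im h
  have h3 : (∫ t in Set.Ioi (0:ℝ), Complex.exp ((-(m : ℂ) + a * I) * t)).im =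
      ∫ t in Set.Ioi (0:ℝ), (Complex.exp ((-(m : ℂ) + a * I) * t)).im :=
    (integral_im (𝕜 := ℂ) hi).symm
  rw [h3] at h2
  have h4 : ∀ t : ℝ, Real.sin (a * t) * (2 * Real.exp (-m * t)) =
     2 * (Complex.exp ((-(m : ℂ) + a * I) * t)).im := by
    intro t
    rw [Complex.exp_im]
    simp
    ring
  simp_rw [h4]
  rw [integral_const_mul, h2]
  simp [Complex.div_im, Complex.normSq_apply]
  ring

theorem sk_int_sin_sinh (a : ℝ) :
    ∫ t in Set.Ioi (0:ℝ), Real.sin (a * t) / Real.sinh t =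
      Real.pi / 2 * (Real.sinh (Real.pi * a / 2) / Real.cosh (Real.pi * a / 2)) := by
  have h : HasSum (fun n : ℕ => ∫ t in Set.Ioi (0:ℝ), Real.sin (a * t) * (2 * Real.exp (-(2 * (n : ℝ) + 1) * t)))
      (∫ t in Set.Ioi (0:ℝ), Real.sin (a * t) / Real.sinh t) := by
    refine hasSum_integral_of_dominated_convergence
      (fun (n : ℕ) t => (|a| * t) * (2 * Real.exp (-(2 * (n : ℝ) + 1) * t))) ?_ ?_ ?_ ?_ ?_
    · intro n
      exact (by fun_prop : Continuous _).aestronglyMeasurable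
    · intro n
      filter_upwards [ae_restrict_mem measurableSet_Ioi] with t (ht : 0 < t)
      rw [norm_mul, Real.norm_of_nonneg (by positivity : 0 ≤ 2 * Real.exp (-(2 * (n : ℝ) + 1) * t))]
      gcongr
      refine (Real.abs_sin_le_abs).trans ?_
      rw [abs_mul, abs_of_pos ht]
    · filter_upwards [ae_restrict_mem measurableSet_Ioi] with t (ht : 0 < t)
      exact ((sk_geom t ht).mul_left _).summable
    · refine (sk_div_sinh_int.const_mul |a|).congr ?_
      filter_upwards [ae_restrict_mem measurableSet_Ioi] with t (ht : 0 < t)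
      rw [((sk_geom t ht).mul_left _).tsum_eq]
      ring
    · filter_upwards [ae_restrict_mem measurableSet_Ioi] with t (ht : 0 < t)
      rw [div_eq_mul_one_div]
      exact (sk_geom t ht).mul_left _
  have h2 := sk_tanh_series a
  refine h.unique ?_
  convert! h2 using 1
  funext n
  exact sk_int_sin a _ (by positivity)

noncomputable def skG (a t : ℝ) : ℝ := (1 / t) * (1 / t - Real.cos (a * t) / Real.sinh t)

theorem sk_diff (b : ℝ) (hb : 0 < b) (x t : ℝ) (ht : 0 < t) :
    skIntegrand b ((x : ℂ) + Complex.I / 2) t - skIntegrand b ((x : ℂ) - Complex.I / 2) t =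
      -Complex.I * (skG (2 * b ^ 2 * x) t : ℂ) := by
  have z1 : (t : ℂ) ≠ 0 := by exact_mod_cast ht.ne'
  have z2 : Complex.sinh (t : ℂ) ≠ 0 := by
    rw [← norm_ne_zero_iff, sk_norm_sinh t ht.le]
    exact (Real.sinh_pos_iff.2 ht).ne'
  have z3 : Complex.sinh ((b : ℂ) ^ 2 * t) ≠ 0 := by
    have := sk_norm_sinh (b ^ 2 * t) (by positivity)
    push_cast at this
    rw [← norm_ne_zero_iff, this]
    exact (Real.sinh_pos_iff.2 (by positivity)).ne'
  have e1 : 2 * (t : ℂ) * (b : ℂ) ^ 2 * ((x : ℂ) + Complex.I / 2) =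
      2 * (b : ℂ) ^ 2 * x * t + ((b : ℂ) ^ 2 * t) * I := by ring
  have e2 : 2 * (t : ℂ) * (b : ℂ) ^ 2 * ((x : ℂ) - Complex.I / 2) =
      2 * (b : ℂ) ^ 2 * x * t - ((b : ℂ) ^ 2 * t) * I := by ring
  unfold skIntegrand skG
  rw [e1, e2, Complex.sin_add, Complex.sin_sub, Complex.cos_mul_I, Complex.sin_mul_I]
  push_cast
  generalize Complex.sinh ((b : ℂ) ^ 2 * t) = B at z3 ⊢
  field_simp
  ring

theorem skG_integrable (a : ℝ) : IntegrableOn (skG a) (Set.Ioi 0) := by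
  have h1 := sk_integrable 1 one_pos (((a / 2 : ℝ) : ℂ) + Complex.I / 2) (by
    simp [abs_of_pos])
  have h2 := sk_integrable 1 one_pos (((a / 2 : ℝ) : ℂ) - Complex.I / 2) (by
    simp [abs_of_pos])
  have h3 := ((h1.sub h2).const_mul Complex.I).re
  refine h3.congr ?_
  filter_upwards [ae_restrict_mem measurableSet_Ioi] with t (ht : 0 < t)
  simp only [Pi.sub_apply]
  rw [sk_diff 1 one_pos (a / 2) t ht]
  have : Complex.I * (-Complex.I * (skG (2 * 1 ^ 2 * (a / 2)) t : ℂ)) = (skG a t : ℂ) := by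
    rw [← mul_assoc]
    simp
    congr 1
    ring
  rw [this]
  simp

theorem skJ_deriv (a : ℝ) :
    HasDerivAt (fun a => ∫ t in Set.Ioi (0:ℝ), skG a t)
      (∫ t in Set.Ioi (0:ℝ), Real.sin (a * t) / Real.sinh t) a := by
  refine (hasDerivAt_integral_of_dominated_loc_of_deriv_le
    (F := skG) (F' := fun a t => Real.sin (a * t) / Real.sinh t)
    (bound := fun t => (|a| + 1) * (t / Real.sinh t)) (s := Metric.ball a 1)
    (Metric.ball_mem_nhds a one_pos) ?_ (skG_integrable a) ?_ ?_ ?_ ?_).2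
  · exact Filter.Eventually.of_forall fun y => (skG_integrable y).1
  · exact sk_div_sinh_cont _ (by fun_prop)
  · filter_upwards [ae_restrict_mem measurableSet_Ioi] with t (ht : 0 < t)
    intro y hy
    have hs := Real.sinh_pos_iff.2 ht
    rw [norm_div, Real.norm_of_nonneg hs.le, ← mul_div_assoc]
    gcongr
    refine (Real.abs_sin_le_abs).trans ?_
    rw [abs_mul, abs_of_pos ht]
    gcongr
    have : |y - a| < 1 := by simpa [Real.dist_eq] using hy
    have h2 : |y| ≤ |a| + |y - a| := by
      simpa using abs_add_le a (y - a)
    linarith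
  · exact sk_div_sinh_int.const_mul _
  · filter_upwards [ae_restrict_mem measurableSet_Ioi] with t (ht : 0 < t)
    intro y hy
    have hs := (Real.sinh_pos_iff.2 ht).ne'
    have h1 : HasDerivAt (fun y : ℝ => y * t) t y := by
      simpa using (hasDerivAt_id y).mul_const t
    have h2 := (((h1.cos).div_const (Real.sinh t)).const_sub (1 / t)).const_mul (1 / t)
    unfold skG
    convert! h2 using 1
    field_simp

theorem skJ_zero : ∫ t in Set.Ioi (0:ℝ), skG 0 t = Real.log 2 := by
  set f : ℝ → ℝ := fun t => Real.cosh t / Real.sinh t - 1 / t with hf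
  have hcont : ContinuousOn f (Set.Ioi 0) := by
    intro t ht
    have h0 : 0 < t := ht
    have h1 : t ≠ 0 := h0.ne'
    have h2 : Real.sinh t ≠ 0 := (Real.sinh_pos_iff.2 h0).ne'
    apply ContinuousAt.continuousWithinAt
    have hA : ContinuousAt (fun t => Real.cosh t / Real.sinh t) t :=
      Real.continuous_cosh.continuousAt.div Real.continuous_sinh.continuousAt h2
    have hB : ContinuousAt (fun t : ℝ => 1 / t) t := continuousAt_const.div continuousAt_id h1
    exact hA.sub hB
  have hL : Filter.Tendsto f (nhdsWithin 0 (Set.Ioi 0)) (nhds 0) := by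
    have hb : Filter.Tendsto (fun t : ℝ => Real.sinh t / (Real.cosh t + 1) + t)
        (nhdsWithin 0 (Set.Ioi 0)) (nhds 0) := by
      have : Continuous (fun t : ℝ => Real.sinh t / (Real.cosh t + 1) + t) := by
        apply Continuous.add _ continuous_id
        apply Real.continuous_sinh.div (Real.continuous_cosh.add continuous_const)
        intro t
        have := Real.cosh_pos t
        exact (add_pos this one_pos).ne'
      have h := this.tendsto 0
      simp only [Real.sinh_zero, zero_div, add_zero] at h
      exact h.mono_left nhdsWithin_le_nhds
    apply squeeze_zero_norm' _ hb
    have e3 : ∀ᶠ t : ℝ in nhdsWithin 0 (Set.Ioi 0), t < 1 := by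
      apply Filter.Eventually.filter_mono nhdsWithin_le_nhds
      exact eventually_lt_nhds one_pos
    filter_upwards [e3, self_mem_nhdsWithin] with t h3 (h0 : 0 < t)
    have hs := Real.sinh_pos_iff.2 h0
    have hc := Real.cosh_pos t
    have hs1 : t ≤ Real.sinh t := Real.self_le_sinh_iff.2 h0.le
    have b1 := sk_sinh_bound t (by simpa [abs_of_pos h0] using h3.le)
    rw [← Complex.ofReal_sinh, ← Complex.ofReal_sub, Complex.norm_real, Complex.norm_real,
      Real.norm_of_nonneg h0.le, Real.norm_eq_abs] at b1
    have e : f t = Real.sinh t / (Real.cosh t + 1) - (Real.sinh t - t) / (t * Real.sinh t)  := by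
      have hsq := Real.cosh_sq t
      have : Real.cosh t + 1 ≠ 0 := by positivity
      simp only [hf]
      field_simp
      ring_nf
      rw [hsq]
      ring
    rw [e]
    refine (norm_sub_le _ _).trans ?_
    rw [Real.norm_of_nonneg (by positivity : 0 ≤ Real.sinh t / (Real.cosh t + 1))]
    gcongr
    rw [norm_div, Real.norm_of_nonneg (by positivity : 0 ≤ t * Real.sinh t), div_le_iff₀ (by positivity),
      Real.norm_eq_abs]
    calc _ ≤ t ^ 3 := b1
      _ = t * (t * t) := by ring
      _ ≤ _ := by gcongr
  have hR : Filter.Tendsto f Filter.atTop (nhds 1) := by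
    have h1 : Filter.Tendsto (fun t : ℝ => Real.cosh t / Real.sinh t) Filter.atTop (nhds 1) := by
      have hE : Filter.Tendsto (fun t : ℝ => Real.exp (-t) / Real.sinh t) Filter.atTop (nhds 0) := by
        apply squeeze_zero' (g := fun t : ℝ => t⁻¹) _ _ tendsto_inv_atTop_zero
        · filter_upwards [Filter.eventually_gt_atTop 0] with t ht
          have := Real.sinh_pos_iff.2 ht
          positivity
        · filter_upwards [Filter.eventually_gt_atTop 0] with t ht
          have hs1 : t ≤ Real.sinh t := Real.self_le_sinh_iff.2 ht.le
          rw [← one_div]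
          gcongr
          exact Real.exp_le_one_iff.2 (by linarith)
      have h2 := hE.const_add 1
      rw [add_zero] at h2
      refine h2.congr' ?_
      filter_upwards [Filter.eventually_gt_atTop 0] with t ht
      have := (Real.sinh_pos_iff.2 ht).ne'
      have h3 := Real.cosh_sub_sinh t
      field_simp
      linarith
    have h2 := h1.sub tendsto_inv_atTop_zero
    simpa [hf] using h2
  have heq : ∀ t ∈ Set.Ioi (0:ℝ), skG 0 t = t⁻¹ • (f (1 * t) - f (1 / 2 * t)) := by
    intro t ht
    have h0 : 0 < t := ht
    have hs := (Real.sinh_pos_iff.2 (show 0 < t / 2 by linarith)).ne'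
    have hc := (Real.cosh_pos (t / 2)).ne'
    have hd : Real.sinh t = 2 * Real.sinh (t / 2) * Real.cosh (t / 2) := by
      rw [← Real.sinh_two_mul]; ring_nf
    have hd2 : Real.cosh t = 1 + 2 * Real.sinh (t / 2) ^ 2 := by
      have : Real.cosh t = Real.cosh (2 * (t / 2)) := by ring_nf
      rw [this, Real.cosh_two_mul, Real.cosh_sq]; ring
    have hsq := Real.cosh_sq (t / 2)
    have h12 : 1 / 2 * t = t / 2 := by ring
    simp only [hf, skG, zero_mul, Real.cos_zero, one_mul, h12, smul_eq_mul]
    rw [hd, hd2]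
    field_simp
    linear_combination (2 * t) * hsq
  have hint : IntegrableOn (fun t => t⁻¹ • (f (1 * t) - f (1 / 2 * t))) (Set.Ioi 0) :=
    (skG_integrable 0).congr_fun heq measurableSet_Ioi
  have h := Frullani.integral_Ioi_eq (hcont.locallyIntegrableOn measurableSet_Ioi) one_pos
    (by norm_num : (0:ℝ) < 1 / 2) hL hR hint
  rw [setIntegral_congr_fun measurableSet_Ioi heq, h]
  simp

theorem skJ_eq (a : ℝ) :
    ∫ t in Set.Ioi (0:ℝ), skG a t = Real.log (2 * Real.cosh (Real.pi * a / 2)) := by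
  have hd : ∀ y : ℝ, HasDerivAt (fun a => (∫ t in Set.Ioi (0:ℝ), skG a t) -
      Real.log (2 * Real.cosh (Real.pi * a / 2))) 0 y := by
    intro y
    have h1 := skJ_deriv y
    rw [sk_int_sin_sinh] at h1
    have h2 : HasDerivAt (fun a : ℝ => Real.pi * a / 2) (Real.pi / 2) y := by
      simpa using ((hasDerivAt_id y).const_mul Real.pi).div_const 2
    have hc := Real.cosh_pos (Real.pi * y / 2)
    have h3 := (h2.cosh.const_mul 2).log (by positivity)
    convert! h1.sub h3 using 1
    field_simp
    ring
  have := is_const_of_deriv_eq_zero (fun y => (hd y).differentiableAt) (fun y => (hd y).deriv) a 0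
  simp only [skJ_zero] at this
  simp at this
  linarith

/-- For `b > 0`: the integral `I(z)` converges absolutely for
`|Im z| ≤ 1/2`, and for every real `x`,
`S_k(x + i/2) = 2 cosh(πb²x) S_k(x - i/2)`. -/
theorem stmt_11 (b : ℝ) (hb : 0 < b) :
    (∀ z : ℂ, |z.im| ≤ 1/2 → IntegrableOn (skIntegrand b z) (Set.Ioi 0)) ∧
    (∀ x : ℝ, Sk b ((x : ℂ) + Complex.I / 2) =
      2 * Complex.cosh ((Real.pi : ℂ) * (b : ℂ) ^ 2 * (x : ℂ)) *
        Sk b ((x : ℂ) - Complex.I / 2)) := by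
  refine ⟨fun z hz => sk_integrable b hb z hz, fun x => ?_⟩
  have h1 := sk_integrable b hb ((x : ℂ) + Complex.I / 2) (by simp [abs_of_pos])
  have h2 := sk_integrable b hb ((x : ℂ) - Complex.I / 2) (by simp [abs_of_pos])
  have h3 : skI b ((x : ℂ) + Complex.I / 2) - skI b ((x : ℂ) - Complex.I / 2) =
      -Complex.I * (Real.log (2 * Real.cosh (Real.pi * (2 * b ^ 2 * x) / 2)) : ℝ) := by
    unfold skI
    rw [← integral_sub h1 h2,
      setIntegral_congr_fun measurableSet_Ioi (fun t ht => sk_diff b hb x t ht),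
      integral_const_mul, integral_complex_ofReal, skJ_eq]
  have hc := Real.cosh_pos (Real.pi * (2 * b ^ 2 * x) / 2)
  have h4 : Complex.I * skI b ((x : ℂ) + Complex.I / 2) =
      (Real.log (2 * Real.cosh (Real.pi * (2 * b ^ 2 * x) / 2)) : ℝ) +
        Complex.I * skI b ((x : ℂ) - Complex.I / 2) := by
    linear_combination Complex.I * h3 -
      (Real.log (2 * Real.cosh (Real.pi * (2 * b ^ 2 * x) / 2)) : ℝ) * Complex.I_mul_I
  unfold Sk
  rw [h4, Complex.exp_add, ← Complex.ofReal_exp, Real.exp_log (by positivity)]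
  push_cast
  congr 3
  ring_nf
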